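/- Let Y, Z be sets, Φ ⊆ Y × Z, and r, t ∈ ℕ with t ≥ 1; for b ∈ Y write Φ_b = {z ∈ Z : (b,z) ∈ Φ}. Assume that for every b ∈ Y the set {b' ∈ Y : b' ≠ b and |Φ_b ∩ Φ_{b'}| ≥ t + 1} has at most r elements, and assume moreover that the transposed relation Φ* = {(z,b) ∈ Z × Y : (b,z) ∈ Φ} admits cuttings with exponent D for some real D ≥ 1. Then there are δ > 0 and a constant c > 0 such that for every n ∈ ℕ and all finite B ⊆ Y, C ⊆ Z with |B| ≤ n and |C| ≤ n, one has |Φ ∩ (B × C)| ≤ c·n^{3/2−δ}. -/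

import Mathlib

open Set

/-- The fiber of a binary relation `E ⊆ U × V` at `a ∈ U`. -/
def fiber {U V : Type*} (E : Set (U × V)) (a : U) : Set V := {v | (a, v) ∈ E}

/-- A set `S` crosses a set `W` if `S ∩ W ≠ ∅` and `W ⊄ S`. -/
def Crosses {V : Type*} (S W : Set V) : Prop := S ∩ W ≠ ∅ ∧ ¬ W ⊆ S

/-- `E` admits cuttings with exponent `D`. -/
def AdmitsCuttings {U V : Type*} (E : Set (U × V)) (D : ℝ) : Prop :=
  ∃ c₀ : ℝ, ∀ (n : ℕ) (A : Set U), A.Finite → A.ncard ≤ n →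
    ∀ r : ℝ, 1 < r → r < (n : ℝ) →
      ∃ (t : ℕ) (Vs : Fin t → Set V),
        (⋃ i, Vs i) = Set.univ ∧ (t : ℝ) ≤ c₀ * r ^ D ∧
        ∀ i : Fin t,
          (({S : Set V | (∃ a ∈ A, S = fiber E a) ∧ Crosses S (Vs i)}.ncard : ℝ)
            ≤ (n : ℝ) / r)

open scoped Finset

open Classical in
/-- The number of pairs of `Φ` in the finite grid `B × C`, counted column by column. -/
noncomputable def incidences {Y Z : Type*} (Φ : Set (Y × Z)) (B : Finset Y) (C : Finset Z) : ℕ :=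
  ∑ z ∈ C, #{b ∈ B | (b, z) ∈ Φ}

/-- Every row `Φ_b` meets at most `r` other rows in more than `t` points. -/
def FewLargeIntersections {Y Z : Type*} (Φ : Set (Y × Z)) (r t : ℕ) : Prop :=
  ∀ b : Y,
    {b' : Y | b' ≠ b ∧ ((t : ℕ∞) + 1) ≤ (fiber Φ b ∩ fiber Φ b').encard}.encard ≤ r

section

variable {Y Z : Type*} {Φ : Set (Y × Z)} {r t : ℕ}

open Classical in
lemma ncard_inter_prod_eq_incidences (B : Finset Y) (C : Finset Z) :
    (Φ ∩ (B : Set Y) ×ˢ (C : Set Z)).ncard = incidences Φ B C := by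
  have hset : Φ ∩ (B : Set Y) ×ˢ (C : Set Z) = ({p ∈ B ×ˢ C | p ∈ Φ} : Finset (Y × Z)) := by
    ext p
    simp [and_comm]
  rw [hset, Set.ncard_coe_finset, incidences, Finset.card_filter, Finset.sum_product_right]
  simp only [Finset.card_filter]

open Classical in
/-- At most `r + 1` rows, that of `b` included, share more than `t` points with `Φ_b`. -/
lemma FewLargeIntersections.card_close_le (h : FewLargeIntersections Φ r t) (b : Y)
    (S : Finset Y)
    (hS : ∀ b' ∈ S, b' = b ∨ ∃ C : Finset Z, t < #C ∧ ∀ z ∈ C, (b, z) ∈ Φ ∧ (b', z) ∈ Φ) :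
    #S ≤ r + 1 := by
  have hsub : ((S.erase b : Finset Y) : Set Y) ⊆
      {b' : Y | b' ≠ b ∧ ((t : ℕ∞) + 1) ≤ (fiber Φ b ∩ fiber Φ b').encard} := by
    intro b' hb'
    rw [Finset.mem_coe, Finset.mem_erase] at hb'
    obtain ⟨C, htC, hC⟩ := (hS b' hb'.2).resolve_left hb'.1
    refine ⟨hb'.1, ?_⟩
    have hCsub : (C : Set Z) ⊆ fiber Φ b ∩ fiber Φ b' := fun z hz => hC z hz
    have hle := Set.encard_le_encard hCsub
    rw [Set.encard_coe_eq_coe_finsetCard] at hle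
    exact le_trans (by exact_mod_cast htC) hle
  have hcard := (Set.encard_le_encard hsub).trans (h b)
  rw [Set.encard_coe_eq_coe_finsetCard, Nat.cast_le] at hcard
  have := Finset.pred_card_le_card_erase (s := S) (a := b)
  omega

lemma FewLargeIntersections.card_le_of_complete (h : FewLargeIntersections Φ r t)
    {B : Finset Y} {C : Finset Z} (hBC : ∀ b ∈ B, ∀ z ∈ C, (b, z) ∈ Φ) (hC : t < #C) :
    #B ≤ r + 1 := by
  obtain rfl | ⟨b, hb⟩ := B.eq_empty_or_nonempty
  · simp
  · exact h.card_close_le b B fun b' hb' =>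
      Or.inr ⟨C, hC, fun z hz => ⟨hBC b hb z hz, hBC b' hb' z hz⟩⟩

open Classical in
/-- The Kővári–Sós–Turán double count. -/
lemma FewLargeIntersections.incidences_sq_le (h : FewLargeIntersections Φ r t)
    (B : Finset Y) (C : Finset Z) :
    incidences Φ B C ^ 2 ≤ #C * (t * #B ^ 2 + (r + 1) * incidences Φ B C) := by
  have hrows : incidences Φ B C = ∑ b ∈ B, #{z ∈ C | (b, z) ∈ Φ} := by
    simp only [incidences, Finset.card_filter]
    exact Finset.sum_comm
  have hpairs : ∑ z ∈ C, #{b ∈ B | (b, z) ∈ Φ} ^ 2 =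
      ∑ b ∈ B, ∑ b' ∈ B, #{z ∈ C | (b, z) ∈ Φ ∧ (b', z) ∈ Φ} := by
    simp only [Finset.card_filter, sq, Finset.sum_mul_sum]
    rw [Finset.sum_comm]
    refine Finset.sum_congr rfl fun b _ => ?_
    rw [Finset.sum_comm]
    refine Finset.sum_congr rfl fun b' _ => Finset.sum_congr rfl fun z _ => ?_
    by_cases h₁ : (b, z) ∈ Φ <;> by_cases h₂ : (b', z) ∈ Φ <;> simp [h₁, h₂]
  have hrow : ∀ b ∈ B, ∑ b' ∈ B, #{z ∈ C | (b, z) ∈ Φ ∧ (b', z) ∈ Φ} ≤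
      t * #B + (r + 1) * #{z ∈ C | (b, z) ∈ Φ} := by
    intro b _
    set S : Finset Y := {b' ∈ B | t < #{z ∈ C | (b, z) ∈ Φ ∧ (b', z) ∈ Φ}} with hS
    have hSr : #S ≤ r + 1 := h.card_close_le b S fun b' hb' =>
      Or.inr ⟨_, (Finset.mem_filter.mp hb').2, fun z hz => (Finset.mem_filter.mp hz).2⟩
    calc ∑ b' ∈ B, #{z ∈ C | (b, z) ∈ Φ ∧ (b', z) ∈ Φ}
        ≤ ∑ b' ∈ B, (t + if t < #{z ∈ C | (b, z) ∈ Φ ∧ (b', z) ∈ Φ} then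
            #{z ∈ C | (b, z) ∈ Φ} else 0) := by
          refine Finset.sum_le_sum fun b' _ => ?_
          split_ifs with hlt
          · exact le_add_left (Finset.card_le_card
              (Finset.monotone_filter_right _ fun z _ hz => hz.1))
          · omega
      _ = t * #B + #S * #{z ∈ C | (b, z) ∈ Φ} := by
          rw [Finset.sum_add_distrib, ← Finset.sum_filter, Finset.sum_const, Finset.sum_const,
            smul_eq_mul, smul_eq_mul, mul_comm t]
      _ ≤ _ := by gcongr
  calc incidences Φ B C ^ 2 ≤ #C * ∑ z ∈ C, #{b ∈ B | (b, z) ∈ Φ} ^ 2 :=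
        sq_sum_le_card_mul_sum_sq
    _ ≤ #C * ∑ b ∈ B, (t * #B + (r + 1) * #{z ∈ C | (b, z) ∈ Φ}) := by
        rw [hpairs]
        exact Nat.mul_le_mul_left _ (Finset.sum_le_sum hrow)
    _ = _ := by
        rw [Finset.sum_add_distrib, ← Finset.mul_sum _ _ (r + 1), ← hrows, Finset.sum_const,
          smul_eq_mul]
        ring

lemma FewLargeIntersections.incidences_le_of_card_le (h : FewLargeIntersections Φ r t)
    (B : Finset Y) (C : Finset Z) {M : ℝ} (hM : (#C : ℝ) ≤ M) :
    (incidences Φ B C : ℝ) ≤ √(t * M) * #B + (r + 1) * M := by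
  have hM0 : 0 ≤ M := (Nat.cast_nonneg _).trans hM
  have hsq : (incidences Φ B C : ℝ) ^ 2 ≤
      M * (t * (#B : ℝ) ^ 2 + (r + 1) * incidences Φ B C) := by
    refine le_trans (by exact_mod_cast h.incidences_sq_le B C) (mul_le_mul_of_nonneg_right hM ?_)
    positivity
  have hs : √(t * M) ^ 2 = t * M := Real.sq_sqrt (by positivity)
  set s := √(t * M)
  have hs0 : 0 ≤ s := Real.sqrt_nonneg _
  by_contra! hlt
  set x : ℝ := (incidences Φ B C : ℝ)
  set β : ℝ := (#B : ℝ)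
  have hβ : 0 ≤ s * β := by positivity
  have hrM : 0 ≤ ((r : ℝ) + 1) * M := by positivity
  have hx : 0 < x := by linarith
  have h₁ : x * (s * β + (r + 1) * M) < x * x := mul_lt_mul_of_pos_left hlt hx
  have h₂ : (s * β) * (s * β) ≤ x * (s * β) := mul_le_mul_of_nonneg_right (by linarith) hβ
  have h₃ : (s * β) * (s * β) = t * M * β ^ 2 := by rw [← hs]; ring
  nlinarith

open Classical in
/-- The incidences in a cell `W`: columns crossing `W` are handled by double counting, the
others are either disjoint from `W` or contain it. -/
lemma FewLargeIntersections.incidences_cell_le (h : FewLargeIntersections Φ r t)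
    (B : Finset Y) (C : Finset Z) {W : Set Y} (hBW : ∀ b ∈ B, b ∈ W) {M : ℝ}
    (hM : (#{z ∈ C | Crosses {b | (b, z) ∈ Φ} W} : ℝ) ≤ M) :
    (incidences Φ B C : ℝ) ≤ (√(t * M) + t) * #B + (r + 1) * (M + #C) := by
  set K : Finset Z := {z ∈ C | Crosses {b | (b, z) ∈ Φ} W} with hK
  set F : Finset Z := {z ∈ C | ∀ b ∈ B, (b, z) ∈ Φ} with hF
  have hsplit : incidences Φ B C ≤ incidences Φ B K + #F * #B := by
    have hFsum : #F * #B = ∑ z ∈ C, if ∀ b ∈ B, (b, z) ∈ Φ then #B else 0 := by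
      rw [← Finset.sum_filter, Finset.sum_const, smul_eq_mul]
    rw [hFsum, incidences, incidences, hK, Finset.sum_filter, ← Finset.sum_add_distrib]
    refine Finset.sum_le_sum fun z _ => ?_
    by_cases hcross : Crosses {b | (b, z) ∈ Φ} W
    · simp [hcross]
    by_cases hfull : ∀ b ∈ B, (b, z) ∈ Φ
    · rw [if_pos hfull]
      exact le_add_left (Finset.card_filter_le _ _)
    have hempty : ({b ∈ B | (b, z) ∈ Φ} : Finset Y) = ∅ := by
      refine Finset.filter_eq_empty_iff.mpr fun b hb hbz => hcross ⟨?_, fun hsub => ?_⟩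
      · exact Set.Nonempty.ne_empty ⟨b, hbz, hBW b hb⟩
      · exact hfull fun b' hb' => hsub (hBW b' hb')
    simp [hempty]
  have hfull : #F * #B ≤ t * #B + (r + 1) * #C := by
    obtain hFt | hFt := le_or_gt #F t
    · exact le_add_right (Nat.mul_le_mul_right _ hFt)
    · have hBr : #B ≤ r + 1 :=
        h.card_le_of_complete (C := F) (fun b hb z hz => (Finset.mem_filter.mp hz).2 b hb) hFt
      have hFC : #F ≤ #C := Finset.card_filter_le _ _
      exact le_add_left ((Nat.mul_le_mul hFC hBr).trans_eq (mul_comm _ _))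
  have hcross := h.incidences_le_of_card_le B K hM
  have htotal : (incidences Φ B C : ℝ) ≤ incidences Φ B K + (t * #B + (r + 1) * #C) := by
    exact_mod_cast hsplit.trans (Nat.add_le_add_left hfull _)
  linarith

open Classical in
/-- Columns that are repeated more than `t` times have at most `r + 1` points. -/
lemma FewLargeIntersections.incidences_le_add_incidences_filter (h : FewLargeIntersections Φ r t)
    (B : Finset Y) (C : Finset Z) :
    incidences Φ B C ≤ (r + 1) * #C + incidences Φ B
      {z ∈ C | #{z' ∈ C | {b | (b, z') ∈ Φ} = {b | (b, z) ∈ Φ}} ≤ t} := by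
  rw [incidences, incidences, Finset.sum_filter, mul_comm, ← smul_eq_mul, ← Finset.sum_const,
    ← Finset.sum_add_distrib]
  refine Finset.sum_le_sum fun z _ => ?_
  split_ifs with hz
  · exact le_add_left le_rfl
  · refine le_add_right (h.card_le_of_complete (fun b hb z' hz' => ?_) (not_le.mp hz))
    have hcol : {b | (b, z') ∈ Φ} = {b | (b, z) ∈ Φ} := (Finset.mem_filter.mp hz').2
    exact (Set.ext_iff.mp hcol b).mpr (Finset.mem_filter.mp hb).2

open Classical in
lemma incidences_eq_sum_incidences_filter {N : ℕ} (idx : Y → Fin N) (B : Finset Y)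
    (C : Finset Z) :
    incidences Φ B C = ∑ i, incidences Φ {b ∈ B | idx b = i} C := by
  simp only [incidences]
  rw [Finset.sum_comm]
  refine Finset.sum_congr rfl fun z _ => ?_
  rw [Finset.card_eq_sum_card_fiberwise (f := idx) (t := Finset.univ) (fun _ _ => by simp)]
  refine Finset.sum_congr rfl fun i _ => ?_
  rw [Finset.filter_comm]

open Classical in
/-- The incidence bound produced by a cutting into `N` cells, each crossed by at most `m` columns. -/
lemma FewLargeIntersections.incidences_le_of_cutting (h : FewLargeIntersections Φ r t)
    (B : Finset Y) (C : Finset Z) {N : ℕ} (Vs : Fin N → Set Y) (hVs : ⋃ i, Vs i = Set.univ)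
    {m : ℝ} (hm : ∀ i, (({S : Set Y | (∃ z ∈ C, S = {b | (b, z) ∈ Φ}) ∧
      Crosses S (Vs i)}.ncard : ℝ) ≤ m)) :
    (incidences Φ B C : ℝ) ≤
      (r + 1) * #C + (√(t * (t * m)) + t) * #B + N * ((r + 1) * (t * m + #C)) := by
  have hcover : ∀ b, ∃ i, b ∈ Vs i := fun b => by
    simpa using (Set.ext_iff.mp hVs b).mpr (Set.mem_univ b)
  choose idx hidx using hcover
  set G : Finset Z := {z ∈ C | #{z' ∈ C | {b | (b, z') ∈ Φ} = {b | (b, z) ∈ Φ}} ≤ t} with hG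
  have hGC : #G ≤ #C := Finset.card_filter_le _ _
  have hcross : ∀ i, (#{z ∈ G | Crosses {b | (b, z) ∈ Φ} (Vs i)} : ℝ) ≤ t * m := by
    intro i
    set K : Finset Z := {z ∈ G | Crosses {b | (b, z) ∈ Φ} (Vs i)} with hK
    have hKG : ∀ z ∈ K, z ∈ G ∧ Crosses {b | (b, z) ∈ Φ} (Vs i) := fun z hz =>
      Finset.mem_filter.mp hz
    have hmult : #K ≤ t * #(K.image fun z => {b | (b, z) ∈ Φ}) := by
      refine Finset.card_le_mul_card_image K t fun S hS => ?_
      obtain ⟨z, hz, rfl⟩ := Finset.mem_image.mp hS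
      refine le_trans (Finset.card_le_card ?_) (Finset.mem_filter.mp (hKG z hz).1).2
      intro z' hz'
      obtain ⟨hz'K, hz'z⟩ := Finset.mem_filter.mp hz'
      exact Finset.mem_filter.mpr ⟨(Finset.mem_filter.mp (hKG z' hz'K).1).1, hz'z⟩
    have himage : #(K.image fun z => {b | (b, z) ∈ Φ}) ≤
        {S : Set Y | (∃ z ∈ C, S = {b | (b, z) ∈ Φ}) ∧ Crosses S (Vs i)}.ncard := by
      rw [← Set.ncard_coe_finset]
      refine Set.ncard_le_ncard ?_ ?_
      · intro S hS
        obtain ⟨z, hz, rfl⟩ := Finset.mem_image.mp hS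
        exact ⟨⟨z, (Finset.mem_filter.mp (hKG z hz).1).1, rfl⟩, (hKG z hz).2⟩
      · refine (C.image fun z => {b | (b, z) ∈ Φ}).finite_toSet.subset ?_
        rintro S ⟨⟨z, hz, rfl⟩, -⟩
        exact Finset.mem_image_of_mem _ hz
    calc (#K : ℝ) ≤ t * (#(K.image fun z => {b | (b, z) ∈ Φ}) : ℝ) := by exact_mod_cast hmult
      _ ≤ t * m := by
        gcongr
        exact le_trans (by exact_mod_cast himage) (hm i)
  have hcells : (incidences Φ B G : ℝ) ≤
      (√(t * (t * m)) + t) * #B + N * ((r + 1) * (t * m + #C)) := by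
    have hB : (#B : ℝ) = ∑ i, (#{b ∈ B | idx b = i} : ℝ) := by
      exact_mod_cast Finset.card_eq_sum_card_fiberwise (f := idx) (t := Finset.univ)
        (fun _ _ => by simp)
    calc (incidences Φ B G : ℝ) = ∑ i, (incidences Φ {b ∈ B | idx b = i} G : ℝ) := by
          exact_mod_cast incidences_eq_sum_incidences_filter idx B G
      _ ≤ ∑ i, ((√(t * (t * m)) + t) * (#{b ∈ B | idx b = i} : ℝ) +
            (r + 1) * (t * m + #C)) := by
          refine Finset.sum_le_sum fun i _ => ?_
          refine (h.incidences_cell_le {b ∈ B | idx b = i} G (W := Vs i) ?_ (hcross i)).trans ?_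
          · intro b hb
            rw [← (Finset.mem_filter.mp hb).2]
            exact hidx b
          · gcongr
      _ = _ := by
          rw [Finset.sum_add_distrib, ← Finset.mul_sum, ← hB]
          simp
  have hsplit : (incidences Φ B C : ℝ) ≤ (r + 1) * #C + incidences Φ B G := by
    exact_mod_cast h.incidences_le_add_incidences_filter B C
  linarith

open Classical in
lemma incidences_le_card_mul_card (B : Finset Y) (C : Finset Z) :
    incidences Φ B C ≤ #C * #B := by
  rw [incidences, ← smul_eq_mul, ← Finset.sum_const]
  exact Finset.sum_le_sum fun z _ => Finset.card_filter_le _ _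

/-- A cutting with parameter `n ^ (1 / (4 * D))` balances the two error terms. -/
lemma FewLargeIntersections.exists_incidences_le (h : FewLargeIntersections Φ r t) {D : ℝ}
    (hD : 1 ≤ D) (hcut : AdmitsCuttings {q : Z × Y | (q.2, q.1) ∈ Φ} D) :
    ∃ c : ℝ, 0 < c ∧ ∀ (n : ℕ) (B : Finset Y) (C : Finset Z), #B ≤ n → #C ≤ n →
      (incidences Φ B C : ℝ) ≤ c * (n : ℝ) ^ ((3 : ℝ) / 2 - 1 / (8 * D)) := by
  obtain ⟨c₀, hc₀⟩ := hcut
  have hD0 : 0 < D := by linarith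
  refine ⟨(r + 1) + (t + t) + |c₀| * ((r + 1) * (t + 1)), by positivity, ?_⟩
  intro n B C hB hC
  obtain hn | hn := lt_or_ge n 2
  · have hI := (incidences_le_card_mul_card (Φ := Φ) B C).trans (Nat.mul_le_mul hC hB)
    interval_cases n
    · have h0 : incidences Φ B C = 0 := by omega
      rw [h0, Nat.cast_zero]
      positivity
    · have h1 : (incidences Φ B C : ℝ) ≤ 1 := by exact_mod_cast hI
      rw [Nat.cast_one, Real.one_rpow, mul_one]
      have : 0 ≤ (r : ℝ) + (t + t) + |c₀| * ((r + 1) * (t + 1)) := by positivity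
      linarith
  have hn1 : (1 : ℝ) < n := by exact_mod_cast hn
  have hn0 : (0 : ℝ) < n := by linarith
  set δ : ℝ := 1 / (8 * D) with hδ
  have hδ8 : δ ≤ 1 / 8 := one_div_le_one_div_of_le (by norm_num) (by linarith)
  have hδ0 : 0 < δ := by positivity
  have hδD : 2 * δ * D = 1 / 4 := by rw [hδ]; field_simp; norm_num
  set R : ℝ := (n : ℝ) ^ (2 * δ) with hR
  have hR1 : 1 < R := Real.one_lt_rpow hn1 (by linarith)
  have hRn : R < n := by
    simpa using Real.rpow_lt_rpow_of_exponent_lt hn1 (show 2 * δ < 1 by linarith)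
  obtain ⟨N, Vs, hVs, hN, hm⟩ := hc₀ n C C.finite_toSet (by rwa [Set.ncard_coe_finset]) R hR1 hRn
  have hbound := h.incidences_le_of_cutting B C Vs hVs (m := n / R) hm
  set X : ℝ := (n : ℝ) ^ ((3 : ℝ) / 2 - δ) with hX
  have hnX : (n : ℝ) ≤ X := by
    simpa using Real.rpow_le_rpow_of_exponent_le hn1.le (show 1 ≤ (3 : ℝ) / 2 - δ by linarith)
  have hNX : (N : ℝ) * n ≤ |c₀| * X := by
    have hRD : R ^ D = (n : ℝ) ^ ((1 : ℝ) / 4) := by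
      rw [hR, ← Real.rpow_mul hn0.le, hδD]
    calc (N : ℝ) * n ≤ |c₀| * R ^ D * n := by
          gcongr
          exact hN.trans (by gcongr; exact le_abs_self c₀)
      _ = |c₀| * (n : ℝ) ^ ((1 : ℝ) / 4 + 1) := by
          rw [hRD, Real.rpow_add hn0, Real.rpow_one, mul_assoc]
      _ ≤ |c₀| * X := by
          gcongr
          exact Real.rpow_le_rpow_of_exponent_le hn1.le (by linarith)
  have hsqrt : √(t * (t * (n / R))) * n = t * X := by
    have hnR : (n : ℝ) / R = ((n : ℝ) ^ ((1 : ℝ) / 2 - δ)) ^ 2 := by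
      rw [hR, ← Real.rpow_natCast, ← Real.rpow_mul hn0.le]
      nth_rewrite 1 [← Real.rpow_one (n : ℝ)]
      rw [← Real.rpow_sub hn0]
      congr 1
      push_cast
      ring
    have hsq : (t : ℝ) * (t * (n / R)) = (t * (n : ℝ) ^ ((1 : ℝ) / 2 - δ)) ^ 2 := by
      rw [hnR]
      ring
    rw [hsq, Real.sqrt_sq (by positivity), mul_assoc, ← Real.rpow_add_one hn0.ne', hX]
    congr 2
    ring
  have hnR : (n : ℝ) / R ≤ n := div_le_self hn0.le hR1.le
  have hBn : (#B : ℝ) ≤ n := by exact_mod_cast hB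
  have hCn : (#C : ℝ) ≤ n := by exact_mod_cast hC
  calc (incidences Φ B C : ℝ)
      ≤ (r + 1) * #C + (√(t * (t * (n / R))) + t) * #B +
          N * ((r + 1) * (t * (n / R) + #C)) := hbound
    _ ≤ (r + 1) * n + (√(t * (t * (n / R))) + t) * n + N * ((r + 1) * (t * n + n)) := by
        gcongr
    _ = (r + 1) * n + (√(t * (t * (n / R))) * n + t * n) + (N * n) * ((r + 1) * (t + 1)) := by
        ring
    _ ≤ (r + 1) * X + (t * X + t * X) + (|c₀| * X) * ((r + 1) * (t + 1)) := by
        rw [hsqrt]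
        gcongr
    _ = _ := by ring

end

theorem stmt10 {Y Z : Type*} (Φ : Set (Y × Z)) (r t : ℕ) (ht : 1 ≤ t)
    (h : ∀ b : Y,
      {b' : Y | b' ≠ b ∧ ((t : ℕ∞) + 1) ≤ (fiber Φ b ∩ fiber Φ b').encard}.encard ≤ r)
    (hcut : ∃ D : ℝ, 1 ≤ D ∧
      AdmitsCuttings {q : Z × Y | (q.2, q.1) ∈ Φ} D) :
    ∃ δ : ℝ, 0 < δ ∧ ∃ c : ℝ, 0 < c ∧
      ∀ (n : ℕ) (B : Set Y) (C : Set Z), B.Finite → C.Finite →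
        B.ncard ≤ n → C.ncard ≤ n →
        ((Φ ∩ B ×ˢ C).ncard : ℝ) ≤ c * (n : ℝ) ^ ((3 : ℝ) / 2 - δ) := by
  obtain ⟨D, hD, hcut⟩ := hcut
  obtain ⟨c, hc, hbound⟩ := FewLargeIntersections.exists_incidences_le h hD hcut
  refine ⟨1 / (8 * D), by positivity, c, hc, fun n B C hB hC hBn hCn => ?_⟩
  lift B to Finset Y using hB
  lift C to Finset Z using hC
  rw [Set.ncard_coe_finset] at hBn hCn
  rw [ncard_inter_prod_eq_incidences]
  exact hbound n B C hBn hCn
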